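/- Let u be a smooth solution of the heat equation Δ_x u = ∂_t u on all of ℝⁿ × ℝ satisfying |u(x,t)| ≤ c₀(|x| + √|t| + 1)^q for all (x,t) ∈ ℝⁿ × ℝ, for some constants c₀ > 0 and q ≥ 1. Then for every integer k > q/2, the k-th time derivative vanishes identically: ∂_t^k u(x,t) = 0 for all (x,t) ∈ ℝⁿ × ℝ. -/

import Mathlib

open MeasureTheory Real

noncomputable section

/-- Spatial Laplacian of `f : ℝⁿ → ℝ` at `x` (sum of second partial derivatives). -/
def lap (n : ℕ) (f : EuclideanSpace ℝ (Fin n) → ℝ) (x : EuclideanSpace ℝ (Fin n)) : ℝ :=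
  ∑ i : Fin n, fderiv ℝ (fun y => fderiv ℝ f y (EuclideanSpace.single i 1)) x
    (EuclideanSpace.single i 1)

/-- `u` is a smooth ancient solution of the heat equation on `ℝⁿ × (-∞, 0]`:
it is smooth and satisfies `Δ_x u = ∂_t u` for all `t ≤ 0`. -/
def IsAncientHeat (n : ℕ) (u : EuclideanSpace ℝ (Fin n) × ℝ → ℝ) : Prop :=
  ContDiff ℝ (⊤ : ℕ∞) u ∧ ∀ (x : EuclideanSpace ℝ (Fin n)) (t : ℝ), t ≤ 0 →
    lap n (fun y => u (y, t)) x = deriv (fun s => u (x, s)) t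

open Set Metric

/-- The directional derivative of `f` along the constant vector field `v`. -/
def dirDeriv {F : Type*} [NormedAddCommGroup F] [NormedSpace ℝ F] (v : F) (f : F → ℝ) : F → ℝ :=
  fun p => fderiv ℝ f p v

section DirDeriv

variable {F : Type*} [NormedAddCommGroup F] [NormedSpace ℝ F] {f g : F → ℝ}

theorem contDiff_dirDeriv (hf : ContDiff ℝ (⊤ : ℕ∞) f) (v : F) :
    ContDiff ℝ (⊤ : ℕ∞) (dirDeriv v f) :=
  (hf.fderiv_right (by simp)).clm_apply contDiff_const

theorem dirDeriv_mul (hf : ContDiff ℝ (⊤ : ℕ∞) f) (hg : ContDiff ℝ (⊤ : ℕ∞) g) (v p : F) :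
    dirDeriv v (fun p => f p * g p) p = f p * dirDeriv v g p + dirDeriv v f p * g p := by
  have hf' := hf.differentiable (by simp) p
  have hg' := hg.differentiable (by simp) p
  simp [dirDeriv, fderiv_fun_mul hf' hg', mul_comm]

theorem dirDeriv_sum {ι : Type*} (s : Finset ι) {f : ι → F → ℝ}
    (hf : ∀ i, ContDiff ℝ (⊤ : ℕ∞) (f i)) (v : F) :
    dirDeriv v (fun p => ∑ i ∈ s, f i p) = fun p => ∑ i ∈ s, dirDeriv v (f i) p := by
  funext p
  have hf' : ∀ i ∈ s, DifferentiableAt ℝ (f i) p := fun i _ =>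
    (hf i).differentiable (by simp) p
  simp [dirDeriv, fderiv_fun_sum hf']

theorem dirDeriv_comm (hf : ContDiff ℝ (⊤ : ℕ∞) f) (v w : F) :
    dirDeriv v (dirDeriv w f) = dirDeriv w (dirDeriv v f) := by
  funext p
  have hd : DifferentiableAt ℝ (fderiv ℝ f) p :=
    (hf.fderiv_right (m := (⊤ : ℕ∞)) (by simp)).differentiable (by simp) p
  have hs : IsSymmSndFDerivAt ℝ f p := by
    apply hf.contDiffAt.isSymmSndFDerivAt
    simp only [minSmoothness_of_isRCLikeNormedField]
    exact WithTop.coe_le_coe.2 le_top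
  have h : ∀ a b : F, dirDeriv a (dirDeriv b f) p = fderiv ℝ (fderiv ℝ f) p a b := by
    intro a b
    change fderiv ℝ (fun y => fderiv ℝ f y b) p a = _
    rw [fderiv_clm_apply hd (differentiableAt_const b)]
    simp
  rw [h, h, hs.eq]

theorem integral_dirDeriv_eq_zero [FiniteDimensional ℝ F] [MeasurableSpace F] [BorelSpace F]
    (μ : Measure F) [μ.IsAddHaarMeasure] (hf : ContDiff ℝ (⊤ : ℕ∞) f)
    (hc : HasCompactSupport f) (v : F) : ∫ p, dirDeriv v f p ∂μ = 0 := by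
  have hi : Integrable f μ := hf.continuous.integrable_of_hasCompactSupport hc
  have hi' : Integrable (dirDeriv v f) μ :=
    (contDiff_dirDeriv hf v).continuous.integrable_of_hasCompactSupport (hc.fderiv_apply ℝ v)
  have := integral_smul_fderiv_eq_neg_fderiv_smul_of_integrable (μ := μ) (𝕜 := ℝ)
    (f := fun _ => (1 : ℝ)) (g := f) (v := v) (by simp)
    (by simp only [one_smul]; exact hi') (by simpa using hi)
    (fun _ _ => differentiableAt_const _) (fun x _ => hf.differentiable (by simp) x)
  simpa [dirDeriv] using this

theorem dirDeriv_eq_zero_of_notMem_tsupport {p : F} (hp : p ∉ tsupport f) (v : F) :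
    dirDeriv v f p = 0 := by
  by_contra h
  exact hp (tsupport_fderiv_apply_subset ℝ v (subset_tsupport _ h))

theorem dirDeriv_comp_clm {G : Type*} [NormedAddCommGroup G] [NormedSpace ℝ G]
    (hf : ContDiff ℝ (⊤ : ℕ∞) f) (L : G →L[ℝ] F) (v p : G) :
    dirDeriv v (fun p => f (L p)) p = dirDeriv (L v) f (L p) := by
  have h := (hf.differentiable (by simp) (L p)).hasFDerivAt.comp p L.hasFDerivAt
  change fderiv ℝ (f ∘ L) p v = _
  rw [h.fderiv]
  rfl

theorem dirDeriv_smul (c : ℝ) (v : F) (f : F → ℝ) (p : F) :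
    dirDeriv (c • v) f p = c * dirDeriv v f p := by
  simp [dirDeriv]

end DirDeriv

instance (n : ℕ) : (volume : Measure (EuclideanSpace ℝ (Fin n) × ℝ)).IsAddHaarMeasure :=
  Measure.prod.instIsAddHaarMeasure _ _

/-- The spatial coordinate direction `e_i` in space-time. -/
def spaceDir {n : ℕ} (i : Fin n) : EuclideanSpace ℝ (Fin n) × ℝ := (EuclideanSpace.single i 1, 0)

/-- The time direction in space-time. -/
def timeDir (n : ℕ) : EuclideanSpace ℝ (Fin n) × ℝ := (0, 1)

/-- Smooth solutions of the heat equation on all of `ℝⁿ × ℝ`. -/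
structure IsEternalHeat {n : ℕ} (u : EuclideanSpace ℝ (Fin n) × ℝ → ℝ) : Prop where
  contDiff : ContDiff ℝ (⊤ : ℕ∞) u
  heat_eq : (fun p => ∑ i, dirDeriv (spaceDir i) (dirDeriv (spaceDir i) u) p) =
    dirDeriv (timeDir n) u

/-- The parabolic cylinder of radius `R` centred at the origin. -/
def parabolicCylinder (n : ℕ) (R : ℝ) : Set (EuclideanSpace ℝ (Fin n) × ℝ) :=
  closedBall 0 R ×ˢ closedBall 0 (R ^ 2)

/-- The squared `L²` norm on parabolic cylinders of radius `R` is `O(R ^ a)`. -/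
def HasL2Growth {n : ℕ} (a : ℝ) (u : EuclideanSpace ℝ (Fin n) × ℝ → ℝ) : Prop :=
  ∃ C : ℝ, ∀ R : ℝ, 1 ≤ R → ∫ p in parabolicCylinder n R, u p ^ 2 ≤ C * R ^ a

/-- The weight multiplying `u ^ 2` in the Caccioppoli inequality with cutoff `φ`. -/
def caccioppoliWeight {n : ℕ} (φ : EuclideanSpace ℝ (Fin n) × ℝ → ℝ)
    (p : EuclideanSpace ℝ (Fin n) × ℝ) : ℝ :=
  4 * ∑ i, dirDeriv (spaceDir i) φ p ^ 2 + 2 * φ p * dirDeriv (timeDir n) φ p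

section Heat

variable {n : ℕ} {u v φ : EuclideanSpace ℝ (Fin n) × ℝ → ℝ} {a : ℝ}

theorem IsEternalHeat.directional (hu : IsEternalHeat u) (w : EuclideanSpace ℝ (Fin n) × ℝ) :
    IsEternalHeat (dirDeriv w u) where
  contDiff := contDiff_dirDeriv hu.contDiff w
  heat_eq := by
    have h (i : Fin n) := contDiff_dirDeriv hu.contDiff (spaceDir i)
    rw [dirDeriv_comm hu.contDiff, ← hu.heat_eq,
      dirDeriv_sum _ fun i => contDiff_dirDeriv (h i) _]
    funext p
    refine Finset.sum_congr rfl fun i _ => ?_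
    rw [dirDeriv_comm hu.contDiff _ w, dirDeriv_comm (h i) _ w]

theorem continuous_caccioppoliWeight (hφ : ContDiff ℝ (⊤ : ℕ∞) φ) :
    Continuous (caccioppoliWeight φ) :=
  (continuous_const.mul (continuous_finsetSum _ fun _ _ =>
    (contDiff_dirDeriv hφ _).continuous.pow 2)).add
    ((continuous_const.mul hφ.continuous).mul (contDiff_dirDeriv hφ _).continuous)

theorem caccioppoliWeight_eq_zero_of_notMem_tsupport {p : EuclideanSpace ℝ (Fin n) × ℝ}
    (hp : p ∉ tsupport φ) : caccioppoliWeight φ p = 0 := by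
  simp [caccioppoliWeight, dirDeriv_eq_zero_of_notMem_tsupport hp]

theorem integrable_sq_mul_sum_dirDeriv_sq (hu : ContDiff ℝ (⊤ : ℕ∞) u)
    (hφ : ContDiff ℝ (⊤ : ℕ∞) φ) (hc : HasCompactSupport φ) :
    Integrable fun p => φ p ^ 2 * ∑ i, dirDeriv (spaceDir i) u p ^ 2 := by
  refine Continuous.integrable_of_hasCompactSupport ?_ ?_
  · exact (hφ.continuous.pow 2).mul
      (continuous_finsetSum _ fun i _ => (contDiff_dirDeriv hu _).continuous.pow 2)
  · simp only [pow_two (φ _)]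
    exact (hc.mul_left (f := φ)).mul_right

/-- A Caccioppoli inequality for the heat equation. -/
theorem IsEternalHeat.caccioppoli (hu : IsEternalHeat u) (hφ : ContDiff ℝ (⊤ : ℕ∞) φ)
    (hc : HasCompactSupport φ) :
    ∫ p, φ p ^ 2 * ∑ i, dirDeriv (spaceDir i) u p ^ 2 ≤
      ∫ p, caccioppoliWeight φ p * u p ^ 2 := by
  set D : Fin n → (EuclideanSpace ℝ (Fin n) × ℝ → ℝ) → EuclideanSpace ℝ (Fin n) × ℝ → ℝ :=
    fun i => dirDeriv (spaceDir i) with hD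
  set T : (EuclideanSpace ℝ (Fin n) × ℝ → ℝ) → EuclideanSpace ℝ (Fin n) × ℝ → ℝ :=
    dirDeriv (timeDir n) with hT
  have su := hu.contDiff
  have sDu (i : Fin n) : ContDiff ℝ (⊤ : ℕ∞) (D i u) := contDiff_dirDeriv su _
  set X : Fin n → EuclideanSpace ℝ (Fin n) × ℝ → ℝ := fun i p => (φ p * φ p) * (u p * D i u p)
  set Y : EuclideanSpace ℝ (Fin n) × ℝ → ℝ := fun p => (φ p * φ p) * (u p * u p)
  have sX (i : Fin n) : ContDiff ℝ (⊤ : ℕ∞) (X i) := (hφ.mul hφ).mul (su.mul (sDu i))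
  have sY : ContDiff ℝ (⊤ : ℕ∞) Y := (hφ.mul hφ).mul (su.mul su)
  have cX (i : Fin n) : HasCompactSupport (X i) := (hc.mul_left (f := φ)).mul_right
  have cY : HasCompactSupport Y := (hc.mul_left (f := φ)).mul_right
  have iDX (i : Fin n) : Integrable (D i (X i)) :=
    (contDiff_dirDeriv (sX i) _).continuous.integrable_of_hasCompactSupport
      ((cX i).fderiv_apply ℝ _)
  have iTY : Integrable (T Y) :=
    (contDiff_dirDeriv sY _).continuous.integrable_of_hasCompactSupport (cY.fderiv_apply ℝ _)
  have hdiv : ∫ p, (2 * ∑ i, D i (X i) p - T Y p) = 0 := by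
    rw [integral_sub ((integrable_finsetSum _ fun i _ => iDX i).const_mul 2) iTY,
      integral_const_mul, integral_finsetSum _ fun i _ => iDX i]
    simp only [hD, hT]
    rw [integral_dirDeriv_eq_zero _ sY cY]
    simp [fun i => integral_dirDeriv_eq_zero volume (sX i) (cX i)]
  have hle (p) : φ p ^ 2 * ∑ i, D i u p ^ 2 -
      caccioppoliWeight φ p * u p ^ 2 ≤ 2 * ∑ i, D i (X i) p - T Y p := by
    have e1 (i : Fin n) : D i (X i) p = φ p * φ p * (u p * D i (D i u) p + D i u p * D i u p)
        + (φ p * D i φ p + D i φ p * φ p) * (u p * D i u p) := by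
      simp only [hD, X]
      rw [dirDeriv_mul (hφ.mul hφ) (su.mul (contDiff_dirDeriv su _)), dirDeriv_mul hφ hφ,
        dirDeriv_mul su (contDiff_dirDeriv su _)]
    have e2 : T Y p = φ p * φ p * (u p * T u p + T u p * u p)
        + (φ p * T φ p + T φ p * φ p) * (u p * u p) := by
      simp only [hT, Y]
      rw [dirDeriv_mul (hφ.mul hφ) (su.mul su), dirDeriv_mul hφ hφ, dirDeriv_mul su su]
    have e3 : ∑ i, D i (D i u) p = T u p := congrFun hu.heat_eq p
    have key : 0 ≤ ∑ i, (φ p * D i u p + 2 * D i φ p * u p) ^ 2 :=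
      Finset.sum_nonneg fun i _ => sq_nonneg _
    have e4 : 2 * ∑ i, D i (X i) p = ∑ i, (φ p * D i u p + 2 * D i φ p * u p) ^ 2
        + φ p ^ 2 * ∑ i, D i u p ^ 2 - 4 * u p ^ 2 * ∑ i, D i φ p ^ 2
        + 2 * φ p ^ 2 * u p * ∑ i, D i (D i u) p := by
      simp only [Finset.mul_sum, ← Finset.sum_add_distrib, ← Finset.sum_sub_distrib]
      refine Finset.sum_congr rfl fun i _ => ?_
      rw [e1]; ring
    have e5 : caccioppoliWeight φ p = 4 * ∑ i, D i φ p ^ 2 + 2 * φ p * T φ p := rfl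
    rw [e4, e2, e3, e5]
    linarith
  have i1 := integrable_sq_mul_sum_dirDeriv_sq su hφ hc
  have i2 : Integrable fun p => caccioppoliWeight φ p * u p ^ 2 := by
    refine Continuous.integrable_of_hasCompactSupport
      ((continuous_caccioppoliWeight hφ).mul (su.continuous.pow 2))
      (HasCompactSupport.mul_right (hc.mono' fun p hp => ?_))
    by_contra hn
    exact hp (caccioppoliWeight_eq_zero_of_notMem_tsupport hn)
  have h := integral_mono (i1.sub i2)
    (((integrable_finsetSum _ fun i _ => iDX i).const_mul 2).sub iTY) hle
  refine sub_nonpos.1 ?_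
  rw [← integral_sub i1 i2]
  exact h.trans hdiv.le

theorem isCompact_parabolicCylinder (n : ℕ) (R : ℝ) : IsCompact (parabolicCylinder n R) :=
  (isCompact_closedBall _ _).prod (isCompact_closedBall _ _)

theorem parabolicCylinder_mono {R S : ℝ} (hR : 0 ≤ R) (h : R ≤ S) :
    parabolicCylinder n R ⊆ parabolicCylinder n S :=
  prod_mono (closedBall_subset_closedBall h) (closedBall_subset_closedBall (by gcongr))

theorem Continuous.integrableOn_parabolicCylinder (hu : Continuous u) (R : ℝ) :
    IntegrableOn u (parabolicCylinder n R) :=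
  hu.continuousOn.integrableOn_compact (isCompact_parabolicCylinder n R)

theorem HasL2Growth.add (hu : Continuous u) (hv : Continuous v) (gu : HasL2Growth a u)
    (gv : HasL2Growth a v) : HasL2Growth a fun p => u p + v p := by
  obtain ⟨C, hC⟩ := gu
  obtain ⟨C', hC'⟩ := gv
  refine ⟨2 * C + 2 * C', fun R hR => ?_⟩
  have iu : IntegrableOn (fun p => u p ^ 2) (parabolicCylinder n R) :=
    (hu.pow 2).integrableOn_parabolicCylinder R
  have iv : IntegrableOn (fun p => v p ^ 2) (parabolicCylinder n R) :=
    (hv.pow 2).integrableOn_parabolicCylinder R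
  calc ∫ p in parabolicCylinder n R, (u p + v p) ^ 2
      ≤ ∫ p in parabolicCylinder n R, (2 * u p ^ 2 + 2 * v p ^ 2) := by
        refine integral_mono (((hu.add hv).pow 2).integrableOn_parabolicCylinder R)
          ((iu.const_mul 2).add (iv.const_mul 2)) fun p => ?_
        simp only
        nlinarith [sq_nonneg (u p - v p)]
    _ = 2 * (∫ p in parabolicCylinder n R, u p ^ 2)
        + 2 * ∫ p in parabolicCylinder n R, v p ^ 2 := by
        rw [integral_add (iu.const_mul 2) (iv.const_mul 2), integral_const_mul, integral_const_mul]
    _ ≤ (2 * C + 2 * C') * R ^ a := by linarith [hC R hR, hC' R hR]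

theorem HasL2Growth.sum {ι : Type*} (s : Finset ι) {f : ι → EuclideanSpace ℝ (Fin n) × ℝ → ℝ}
    (hf : ∀ i, Continuous (f i)) (gf : ∀ i, HasL2Growth a (f i)) :
    HasL2Growth a fun p => ∑ i ∈ s, f i p := by
  classical
  induction s using Finset.induction_on with
  | empty => exact ⟨0, by simp⟩
  | insert i s his ih =>
    simp only [Finset.sum_insert his]
    exact (gf i).add (hf i) (continuous_finsetSum _ fun j _ => hf j) ih

theorem HasL2Growth.eq_zero (hu : Continuous u) (gu : HasL2Growth a u) (ha : a < 0) : u = 0 := by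
  obtain ⟨C, hC⟩ := gu
  have hlim : Filter.Tendsto (fun R : ℝ => C * R ^ a) Filter.atTop (nhds 0) := by
    have := (tendsto_rpow_neg_atTop (neg_pos.2 ha)).const_mul C
    simpa using this
  have hint (R : ℝ) (hR : 1 ≤ R) : ∫ p in parabolicCylinder n R, u p ^ 2 = 0 := by
    refine le_antisymm (ge_of_tendsto hlim ?_) (integral_nonneg fun p => sq_nonneg _)
    filter_upwards [Filter.eventually_ge_atTop R] with S hS
    exact (setIntegral_mono_set ((hu.pow 2).integrableOn_parabolicCylinder S)
      (ae_of_all _ fun p => sq_nonneg _)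
      (parabolicCylinder_mono (by linarith) hS).eventuallyLE).trans (hC S (hR.trans hS))
  have hae (R : ℝ) (hR : 1 ≤ R) : ∀ᵐ p, p ∈ parabolicCylinder n R → u p = 0 := by
    have h := (setIntegral_eq_zero_iff_of_nonneg_ae (ae_of_all _ fun p => sq_nonneg (u p))
      ((hu.pow 2).integrableOn_parabolicCylinder R)).1 (hint R hR)
    have h' := (ae_restrict_iff' (isCompact_parabolicCylinder n R).measurableSet).1 h
    filter_upwards [h'] with p hp hpm
    simpa using hp hpm
  refine (hu.ae_eq_iff_eq volume continuous_const).1 ?_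
  filter_upwards [ae_all_iff.2 fun N : ℕ => hae (N + 1) (by linarith [N.cast_nonneg (α := ℝ)])]
    with p hp
  obtain ⟨N, hN⟩ := exists_nat_ge (max ‖p.1‖ ‖p.2‖)
  have h1 := (le_max_left _ _).trans hN
  have h2 := (le_max_right _ _).trans hN
  refine hp N ⟨?_, ?_⟩
  · simp only [mem_closedBall_zero_iff]; linarith
  · simp only [mem_closedBall_zero_iff]; nlinarith [N.cast_nonneg (α := ℝ)]

theorem hasL2Growth_of_abs_le (hu : Continuous u) {q c : ℝ} (hq : 0 ≤ q) (hc : 0 ≤ c)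
    (h : ∀ p, |u p| ≤ c * (‖p.1‖ + √|p.2| + 1) ^ q) :
    ∃ a, HasL2Growth a u := by
  set d := Module.finrank ℝ (EuclideanSpace ℝ (Fin n) × ℝ)
  set V := volume.real (closedBall (0 : EuclideanSpace ℝ (Fin n) × ℝ) 1)
  refine ⟨q * 2 + (2 * d : ℕ), c ^ 2 * (3 ^ q) ^ 2 * V, fun R hR => ?_⟩
  have hR0 : 0 < R := by linarith
  have hvol : volume.real (parabolicCylinder n R) ≤ R ^ (2 * d) * V := by
    have hsub : parabolicCylinder n R ⊆ closedBall 0 (R ^ 2) := by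
      rw [show (0 : EuclideanSpace ℝ (Fin n) × ℝ) = (0, 0) from rfl, ← closedBall_prod_same]
      exact prod_mono (closedBall_subset_closedBall (by nlinarith)) subset_rfl
    refine (measureReal_mono hsub (isCompact_closedBall _ _).measure_lt_top.ne).trans ?_
    rw [Measure.addHaar_real_closedBall' _ _ (by positivity), pow_mul]
  have hpt : ∀ p ∈ parabolicCylinder n R, u p ^ 2 ≤ c ^ 2 * (3 ^ q) ^ 2 * (R ^ q) ^ 2 := by
    rintro p ⟨h1, h2⟩
    simp only [mem_closedBall_zero_iff] at h1 h2
    have h3 : √|p.2| ≤ R := Real.sqrt_le_iff.2 ⟨hR0.le, h2⟩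
    have h4 : |u p| ≤ c * (3 ^ q * R ^ q) := by
      rw [← Real.mul_rpow (by norm_num) hR0.le]
      refine (h p).trans ?_
      gcongr
      linarith
    rw [← sq_abs]
    calc |u p| ^ 2 ≤ (c * (3 ^ q * R ^ q)) ^ 2 := by gcongr
      _ = _ := by ring
  calc ∫ p in parabolicCylinder n R, u p ^ 2
      ≤ ∫ p in parabolicCylinder n R, c ^ 2 * (3 ^ q) ^ 2 * (R ^ q) ^ 2 :=
        setIntegral_mono_on ((hu.pow 2).integrableOn_parabolicCylinder R)
          (continuous_const.integrableOn_parabolicCylinder R)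
          (isCompact_parabolicCylinder n R).measurableSet hpt
    _ = volume.real (parabolicCylinder n R) * (c ^ 2 * (3 ^ q) ^ 2 * (R ^ q) ^ 2) := by
        rw [setIntegral_const, smul_eq_mul]
    _ ≤ R ^ (2 * d) * V * (c ^ 2 * (3 ^ q) ^ 2 * (R ^ q) ^ 2) := by gcongr
    _ = c ^ 2 * (3 ^ q) ^ 2 * V * R ^ (q * 2 + (2 * d : ℕ)) := by
        rw [Real.rpow_add hR0, Real.rpow_natCast, Real.rpow_mul hR0.le, Real.rpow_ofNat]
        ring

/-- Cutoff functions adapted to parabolic cylinders, with the parabolic scaling of the weight. -/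
theorem exists_parabolic_cutoff (n : ℕ) : ∃ K : ℝ, ∀ R : ℝ, 0 < R →
    ∃ φ : EuclideanSpace ℝ (Fin n) × ℝ → ℝ, ContDiff ℝ (⊤ : ℕ∞) φ ∧ HasCompactSupport φ ∧
      (∀ p ∈ parabolicCylinder n R, φ p = 1) ∧
      (∀ p, p ∉ parabolicCylinder n (2 * R) → caccioppoliWeight φ p = 0) ∧
      ∀ p ∈ parabolicCylinder n (2 * R), caccioppoliWeight φ p ≤ K / R ^ 2 := by
  let b : ContDiffBump (0 : EuclideanSpace ℝ (Fin n) × ℝ) := ⟨1, 2, one_pos, one_lt_two⟩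
  have hb : ContDiff ℝ (⊤ : ℕ∞) b := b.contDiff
  have hz (q : EuclideanSpace ℝ (Fin n) × ℝ) (hq : q ∉ closedBall 0 2) : q ∉ tsupport b := by
    rwa [b.tsupport_eq]
  obtain ⟨K, hK⟩ := (isCompact_closedBall (0 : EuclideanSpace ℝ (Fin n) × ℝ) 2
    ).exists_bound_of_continuousOn (continuous_caccioppoliWeight hb).continuousOn
  have hK0 : 0 ≤ K := (norm_nonneg _).trans (hK 0 (by simp))
  refine ⟨K, fun R hR => ?_⟩
  let L : EuclideanSpace ℝ (Fin n) × ℝ →L[ℝ] EuclideanSpace ℝ (Fin n) × ℝ :=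
    (R⁻¹ • ContinuousLinearMap.fst ℝ _ _).prod ((R ^ 2)⁻¹ • ContinuousLinearMap.snd ℝ _ _)
  have hL (p) : L p = (R⁻¹ • p.1, (R ^ 2)⁻¹ • p.2) := rfl
  have hw (p) : caccioppoliWeight (fun p => b (L p)) p = caccioppoliWeight b (L p) / R ^ 2 := by
    have h1 (i : Fin n) : L (spaceDir i) = R⁻¹ • spaceDir i := by simp [hL, spaceDir]
    have h2 : L (timeDir n) = (R ^ 2)⁻¹ • timeDir n := by simp [hL, timeDir]
    simp only [caccioppoliWeight, dirDeriv_comp_clm hb, h1, h2, dirDeriv_smul, mul_pow,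
      ← Finset.mul_sum]
    field_simp
  have hout (p) (hp : p ∉ parabolicCylinder n (2 * R)) : L p ∉ closedBall 0 2 := by
    contrapose! hp
    rw [mem_closedBall_zero_iff, hL, Prod.norm_def, max_le_iff, norm_smul, norm_smul,
      norm_inv, norm_inv, norm_pow, Real.norm_of_nonneg hR.le, inv_mul_le_iff₀ hR,
      inv_mul_le_iff₀ (by positivity)] at hp
    refine ⟨?_, ?_⟩ <;> rw [mem_closedBall_zero_iff]
    · linarith [hp.1]
    · nlinarith [hp.2, sq_nonneg R]
  refine ⟨fun p => b (L p), hb.comp L.contDiff,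
    HasCompactSupport.intro (isCompact_parabolicCylinder n (2 * R)) fun p hp =>
      image_eq_zero_of_notMem_tsupport (hz _ (hout p hp)), fun p hp => ?_, fun p hp => ?_,
    fun p _ => ?_⟩
  · obtain ⟨h1, h2⟩ := hp
    rw [mem_closedBall_zero_iff] at h1 h2
    apply b.one_of_mem_closedBall
    rw [mem_closedBall_zero_iff, hL, Prod.norm_def, max_le_iff, norm_smul, norm_smul,
      norm_inv, norm_inv, norm_pow, Real.norm_of_nonneg hR.le, inv_mul_le_iff₀ hR,
      inv_mul_le_iff₀ (by positivity)]
    exact ⟨by simpa [b] using h1, by simpa [b] using h2⟩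
  · rw [hw, caccioppoliWeight_eq_zero_of_notMem_tsupport (hz _ (hout p hp)), zero_div]
  · rw [hw]
    gcongr
    by_cases hp : L p ∈ closedBall 0 2
    · exact (le_abs_self _).trans (hK _ hp)
    · rwa [caccioppoliWeight_eq_zero_of_notMem_tsupport (hz _ hp)]

/-- Spatial derivatives lower the `L²` growth exponent by two. -/
theorem IsEternalHeat.hasL2Growth_spaceDir (hu : IsEternalHeat u) (gu : HasL2Growth a u)
    (i : Fin n) : HasL2Growth (a - 2) (dirDeriv (spaceDir i) u) := by
  obtain ⟨C, hC⟩ := gu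
  obtain ⟨K, hK⟩ := exists_parabolic_cutoff n
  refine ⟨|K| * C * 2 ^ a, fun R hR => ?_⟩
  have hR0 : 0 < R := by linarith
  obtain ⟨φ, hφ, hc, h1, h0, hle⟩ := hK R hR0
  have su := hu.contDiff
  have iu : IntegrableOn (fun p => u p ^ 2) (parabolicCylinder n (2 * R)) :=
    (su.continuous.pow 2).integrableOn_parabolicCylinder _
  have ig := integrable_sq_mul_sum_dirDeriv_sq su hφ hc
  calc ∫ p in parabolicCylinder n R, dirDeriv (spaceDir i) u p ^ 2
      ≤ ∫ p in parabolicCylinder n R, φ p ^ 2 * ∑ j, dirDeriv (spaceDir j) u p ^ 2 := by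
        refine setIntegral_mono_on
          (((contDiff_dirDeriv su _).continuous.pow 2).integrableOn_parabolicCylinder R)
          ig.integrableOn (isCompact_parabolicCylinder n R).measurableSet fun p hp => ?_
        rw [h1 p hp, one_pow, one_mul]
        exact Finset.single_le_sum (f := fun j => dirDeriv (spaceDir j) u p ^ 2)
          (fun j _ => sq_nonneg _) (Finset.mem_univ i)
    _ ≤ ∫ p, φ p ^ 2 * ∑ j, dirDeriv (spaceDir j) u p ^ 2 :=
        setIntegral_le_integral ig (ae_of_all _ fun p =>
          mul_nonneg (sq_nonneg _) (Finset.sum_nonneg fun j _ => sq_nonneg _))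
    _ ≤ ∫ p, caccioppoliWeight φ p * u p ^ 2 := hu.caccioppoli hφ hc
    _ = ∫ p in parabolicCylinder n (2 * R), caccioppoliWeight φ p * u p ^ 2 :=
        (setIntegral_eq_integral_of_forall_compl_eq_zero fun p hp => by
          rw [h0 p hp, zero_mul]).symm
    _ ≤ ∫ p in parabolicCylinder n (2 * R), |K| / R ^ 2 * u p ^ 2 := by
        refine setIntegral_mono_on (((continuous_caccioppoliWeight hφ).mul
          (su.continuous.pow 2)).integrableOn_parabolicCylinder _) (iu.const_mul _)
          (isCompact_parabolicCylinder n _).measurableSet fun p hp => ?_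
        gcongr
        refine (hle p hp).trans ?_
        gcongr
        exact le_abs_self K
    _ = |K| / R ^ 2 * ∫ p in parabolicCylinder n (2 * R), u p ^ 2 := integral_const_mul _ _
    _ ≤ |K| / R ^ 2 * (C * (2 * R) ^ a) := by
        gcongr
        exact hC _ (by linarith)
    _ = |K| * C * 2 ^ a * R ^ (a - 2) := by
        rw [Real.mul_rpow (by norm_num) hR0.le, Real.rpow_sub hR0, Real.rpow_ofNat]
        ring

/-- The time derivative lowers the `L²` growth exponent by four. -/
theorem IsEternalHeat.hasL2Growth_timeDir (hu : IsEternalHeat u) (gu : HasL2Growth a u) :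
    HasL2Growth (a - 4) (dirDeriv (timeDir n) u) := by
  rw [← hu.heat_eq]
  refine HasL2Growth.sum _
    (fun i => ((hu.directional (spaceDir i)).directional (spaceDir i)).contDiff.continuous)
    fun i => ?_
  have := (hu.directional (spaceDir i)).hasL2Growth_spaceDir (hu.hasL2Growth_spaceDir gu i) i
  rwa [show a - 2 - 2 = a - 4 by ring] at this

theorem IsEternalHeat.exists_iterate_timeDir_eq_zero (hu : IsEternalHeat u)
    (gu : HasL2Growth a u) : ∃ m : ℕ, (dirDeriv (timeDir n))^[m] u = 0 := by
  have h (m : ℕ) : IsEternalHeat ((dirDeriv (timeDir n))^[m] u) ∧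
      HasL2Growth (a - 4 * m) ((dirDeriv (timeDir n))^[m] u) := by
    induction m with
    | zero => simpa using ⟨hu, gu⟩
    | succ m ih =>
      rw [Function.iterate_succ_apply']
      refine ⟨ih.1.directional _, ?_⟩
      have := ih.1.hasL2Growth_timeDir ih.2
      rwa [show a - 4 * (m + 1 : ℕ) = a - 4 * m - 4 by push_cast; ring]
  obtain ⟨m, hm⟩ := exists_nat_gt a
  have ham : a - 4 * m < 0 := by linarith [m.cast_nonneg (α := ℝ)]
  exact ⟨m, (h m).2.eq_zero (h m).1.contDiff.continuous ham⟩

theorem deriv_slice_eq_dirDeriv (hu : ContDiff ℝ (⊤ : ℕ∞) u) (x : EuclideanSpace ℝ (Fin n))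
    (t : ℝ) : deriv (fun s => u (x, s)) t = dirDeriv (timeDir n) u (x, t) := by
  have h := (hu.differentiable (by simp) (x, t)).hasFDerivAt.comp_hasDerivAt t
    ((hasDerivAt_const t x).prodMk (hasDerivAt_id t))
  exact h.deriv

theorem iteratedDeriv_slice_eq_iterate_dirDeriv (hu : ContDiff ℝ (⊤ : ℕ∞) u) (m : ℕ)
    (x : EuclideanSpace ℝ (Fin n)) (t : ℝ) :
    iteratedDeriv m (fun s => u (x, s)) t = (dirDeriv (timeDir n))^[m] u (x, t) := by
  induction m generalizing u with
  | zero => simp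
  | succ m ih =>
    rw [iteratedDeriv_succ', Function.iterate_succ_apply, ← ih (contDiff_dirDeriv hu _)]
    congr 1
    exact funext fun s => deriv_slice_eq_dirDeriv hu x s

theorem fderiv_slice_eq_dirDeriv (hu : ContDiff ℝ (⊤ : ℕ∞) u) (x : EuclideanSpace ℝ (Fin n))
    (t : ℝ) (i : Fin n) : fderiv ℝ (fun y => u (y, t)) x (EuclideanSpace.single i 1) =
      dirDeriv (spaceDir i) u (x, t) := by
  have h := HasFDerivAt.comp (f := fun y => (y, t)) x
    (hu.differentiable (by simp) (x, t)).hasFDerivAt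
    ((hasFDerivAt_id x).prodMk (hasFDerivAt_const t x))
  exact congrArg (fun A => A (EuclideanSpace.single i 1)) h.fderiv

theorem isEternalHeat_of_lap_eq (hu : ContDiff ℝ (⊤ : ℕ∞) u)
    (h : ∀ x t, lap n (fun y => u (y, t)) x = deriv (fun s => u (x, s)) t) :
    IsEternalHeat u where
  contDiff := hu
  heat_eq := by
    funext ⟨x, t⟩
    rw [← deriv_slice_eq_dirDeriv hu, ← h x t, lap]
    refine Finset.sum_congr rfl fun i _ => ?_
    rw [← fderiv_slice_eq_dirDeriv (contDiff_dirDeriv hu _)]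
    simp only [fderiv_slice_eq_dirDeriv hu]

end Heat

section Polynomial

open Polynomial

theorem exists_polynomial_derivative_eq (P : ℝ[X]) : ∃ Q : ℝ[X], derivative Q = P := by
  induction P using Polynomial.induction_on' with
  | add p q hp hq =>
    obtain ⟨P, rfl⟩ := hp
    obtain ⟨Q, rfl⟩ := hq
    exact ⟨P + Q, derivative_add⟩
  | monomial k c =>
    refine ⟨monomial (k + 1) (c / (k + 1)), ?_⟩
    have : (k : ℝ) + 1 ≠ 0 := by positivity
    rw [derivative_monomial]
    simp [this]

theorem exists_polynomial_of_iteratedDeriv_eq_zero {m : ℕ} {f : ℝ → ℝ}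
    (hf : ContDiff ℝ (⊤ : ℕ∞) f) (h : iteratedDeriv m f = 0) :
    ∃ P : ℝ[X], f = fun t => P.eval t := by
  induction m generalizing f with
  | zero => exact ⟨0, by simpa [funext_iff] using h⟩
  | succ m ih =>
    have hd : Differentiable ℝ f := hf.differentiable (by simp)
    rw [iteratedDeriv_succ'] at h
    obtain ⟨P, hP⟩ := ih ((contDiff_infty_iff_deriv.1 hf).2) h
    obtain ⟨Q, rfl⟩ := exists_polynomial_derivative_eq P
    have hc := is_const_of_deriv_eq_zero (hd.sub Q.differentiable) fun t => by
      rw [deriv_sub (hd t) Q.differentiableAt, hP, Q.deriv, sub_self]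
    refine ⟨Q + C (f 0 - Q.eval 0), funext fun t => ?_⟩
    have := hc t 0
    simp only [Pi.sub_apply] at this
    rw [eval_add, eval_C]
    linarith

theorem iteratedDeriv_polynomial_eval (k : ℕ) (P : ℝ[X]) :
    iteratedDeriv k (fun t => P.eval t) = fun t => (derivative^[k] P).eval t := by
  induction k generalizing P with
  | zero => simp
  | succ k ih =>
    rw [iteratedDeriv_succ', Function.iterate_succ_apply, ← ih]
    congr 1
    exact funext fun t => P.deriv

theorem polynomial_degree_lt_of_abs_eval_le {P : ℝ[X]} {A c q : ℝ} {k : ℕ} (hq : 0 ≤ q)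
    (hA : 0 ≤ A) (hc : 0 ≤ c) (hk : q / 2 < k) (h : ∀ t, |P.eval t| ≤ c * (A + √|t|) ^ q) :
    P.degree < k := by
  have hlim : Filter.Tendsto (fun t : ℝ => c * 2 ^ q * t ^ (q / 2 - k)) Filter.atTop (nhds 0) := by
    have := (tendsto_rpow_neg_atTop (sub_pos.2 hk)).const_mul (c * 2 ^ q)
    simpa using this
  have hX := Polynomial.div_tendsto_atTop_zero_iff_degree_lt P (X ^ k) (pow_ne_zero k X_ne_zero)
  rw [degree_X_pow] at hX
  refine hX.1 (squeeze_zero_norm' ?_ hlim)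
  filter_upwards [Filter.eventually_ge_atTop (A ^ 2), Filter.eventually_gt_atTop 0] with t ht ht0
  have hAt : A ≤ √t := Real.le_sqrt_of_sq_le ht
  rw [eval_pow, eval_X, norm_div, norm_pow, Real.norm_of_nonneg ht0.le, Real.norm_eq_abs,
    Real.rpow_sub ht0, Real.rpow_natCast, ← mul_div_assoc]
  gcongr
  calc |P.eval t| ≤ c * (A + √|t|) ^ q := h t
    _ ≤ c * (2 * √t) ^ q := by
        rw [abs_of_pos ht0]
        gcongr
        linarith
    _ = c * 2 ^ q * t ^ (q / 2) := by
        rw [Real.mul_rpow (by norm_num) (Real.sqrt_nonneg t), Real.sqrt_eq_rpow,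
          ← Real.rpow_mul ht0.le, mul_assoc]
        ring_nf

end Polynomial

/-- an eternal smooth solution of the heat equation on `ℝⁿ × ℝ` with
polynomial growth of degree at most `q` has vanishing `k`-th time derivative for every
integer `k > q/2`. -/
theorem eternal_poly_growth_time_derivative_vanishes (n : ℕ)
    (u : EuclideanSpace ℝ (Fin n) × ℝ → ℝ)
    (hsm : ContDiff ℝ (⊤ : ℕ∞) u)
    (heq : ∀ (x : EuclideanSpace ℝ (Fin n)) (t : ℝ),
      lap n (fun y => u (y, t)) x = deriv (fun s => u (x, s)) t)
    (q c₀ : ℝ) (hq : 1 ≤ q) (hc₀ : 0 < c₀)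
    (hgr : ∀ (x : EuclideanSpace ℝ (Fin n)) (t : ℝ),
      |u (x, t)| ≤ c₀ * (‖x‖ + Real.sqrt |t| + 1) ^ q) :
    ∀ k : ℕ, q / 2 < (k : ℝ) →
      ∀ (x : EuclideanSpace ℝ (Fin n)) (t : ℝ),
        iteratedDeriv k (fun s => u (x, s)) t = 0 := by
  intro k hk x t
  have hq0 : 0 ≤ q := by linarith
  obtain ⟨a, ga⟩ := hasL2Growth_of_abs_le hsm.continuous hq0 hc₀.le fun p => hgr p.1 p.2
  obtain ⟨m, hm⟩ := (isEternalHeat_of_lap_eq hsm heq).exists_iterate_timeDir_eq_zero ga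
  have hsl : iteratedDeriv m (fun s => u (x, s)) = 0 := by
    funext s
    rw [iteratedDeriv_slice_eq_iterate_dirDeriv hsm, hm]
    rfl
  obtain ⟨P, hP⟩ := exists_polynomial_of_iteratedDeriv_eq_zero
    (hsm.comp (contDiff_const.prodMk contDiff_id)) hsl
  have hdeg : P.degree < k := by
    refine polynomial_degree_lt_of_abs_eval_le hq0 (A := ‖x‖ + 1) (by positivity) hc₀.le hk
      fun s => ?_
    rw [← congrFun hP s, add_right_comm]
    exact hgr x s
  rw [show (fun s => u (x, s)) = fun s => P.eval s from hP, iteratedDeriv_polynomial_eval]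
  simp [Polynomial.iterate_derivative_eq_zero_of_degree_lt hdeg]
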